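/- arXiv:2106.10424 — 2 statements merged into one kernel-verified Lean document; each statement's English description precedes it below -/
import Mathlib

section
/- Let M be any episodic tabular MDP with a deterministic expert policy π^E (each π^E_h(·|s) is a point mass). Let D consist of m ≥ 1 i.i.d. trajectories drawn from the trajectory distribution of π^E, let P̂_h be the empirical maximum-likelihood estimate of P^{π^E}_h computed from D, and let π^{AIL}(D) be any (measurable) choice of global minimizer over all policies of L(π) = Σ_{h=1}^H Σ_{(s,a)} |P^π_h(s,a) − P̂_h(s,a)|. Then E_D[ |V^{π^E} − V^{π^{AIL}(D)}| ] ≤ 2H·√((|S| − 1)/m). In particular, for VAIL to obtain an ε-optimal policy in expectation, at most O(|S|H²/ε²) expert trajectories suffice. -/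
open Finset

/-- State distribution `d^π_h` of a policy `π` in an episodic tabular MDP
(time steps are 0-indexed: `stateDist ρ P π 0 = ρ`). -/
noncomputable def stateDist {S A : Type*} [Fintype S] [Fintype A] (ρ : S → ℝ)
    (P : ℕ → S → A → S → ℝ) (π : ℕ → S → A → ℝ) : ℕ → S → ℝ
  | 0 => ρ
  | h + 1 => fun s' => ∑ s : S, ∑ a : A, stateDist ρ P π h s * π h s a * P h s a s'

/-- State-action distribution `P^π_h(s,a) = d^π_h(s) π_h(a|s)`. -/
noncomputable def saDist {S A : Type*} [Fintype S] [Fintype A] (ρ : S → ℝ)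
    (P : ℕ → S → A → S → ℝ) (π : ℕ → S → A → ℝ) (h : ℕ) (s : S) (a : A) : ℝ :=
  stateDist ρ P π h s * π h s a

/-- Policy value `V^π = Σ_{h<H} Σ_{(s,a)} P^π_h(s,a) r_h(s,a)`. -/
noncomputable def policyValue {S A : Type*} [Fintype S] [Fintype A] (ρ : S → ℝ)
    (P : ℕ → S → A → S → ℝ) (π : ℕ → S → A → ℝ) (r : ℕ → S → A → ℝ) (H : ℕ) : ℝ :=
  ∑ h ∈ Finset.range H, ∑ s : S, ∑ a : A, saDist ρ P π h s a * r h s a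

/-- `π` is a (Markovian, non-stationary) policy. -/
def IsPolicy {S A : Type*} [Fintype A] (π : ℕ → S → A → ℝ) : Prop :=
  ∀ h s, (∀ a, 0 ≤ π h s a) ∧ (∑ a : A, π h s a) = 1

/-- `P` is a transition function. -/
def IsTransition {S A : Type*} [Fintype S] (P : ℕ → S → A → S → ℝ) : Prop :=
  ∀ h s a, (∀ s', 0 ≤ P h s a s') ∧ (∑ s' : S, P h s a s') = 1

/-- `ρ` is an initial state distribution. -/
def IsInitDist {S : Type*} [Fintype S] (ρ : S → ℝ) : Prop :=
  (∀ s, 0 ≤ ρ s) ∧ (∑ s : S, ρ s) = 1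

/-- Rewards take values in `[0,1]`. -/
def IsReward {S A : Type*} (r : ℕ → S → A → ℝ) : Prop :=
  ∀ h s a, 0 ≤ r h s a ∧ r h s a ≤ 1

/-- The VAIL state-action distribution matching objective
`L(π) = Σ_{h<H} Σ_{(s,a)} |P^π_h(s,a) − Q_h(s,a)|`. -/
noncomputable def vailLoss {S A : Type*} [Fintype S] [Fintype A] (ρ : S → ℝ)
    (P : ℕ → S → A → S → ℝ) (π : ℕ → S → A → ℝ) (Q : ℕ → S → A → ℝ) (H : ℕ) : ℝ :=
  ∑ h ∈ Finset.range H, ∑ s : S, ∑ a : A, |saDist ρ P π h s a - Q h s a|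

/-- Probability of the (truncated) trajectory `t` of length `H` under policy `π`. -/
noncomputable def trajProb {S A : Type*} [Fintype S] [Fintype A] (ρ : S → ℝ)
    (P : ℕ → S → A → S → ℝ) (π : ℕ → S → A → ℝ) (H : ℕ) (t : ℕ → S × A) : ℝ :=
  ρ (t 0).1 * π 0 (t 0).1 (t 0).2 *
    ∏ ℓ ∈ Finset.range (H - 1),
      (P ℓ (t ℓ).1 (t ℓ).2 (t (ℓ + 1)).1 * π (ℓ + 1) (t (ℓ + 1)).1 (t (ℓ + 1)).2)

/-- Extend a length-`H` trajectory to a function on all of `ℕ`. -/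
noncomputable def extendTraj {S A : Type*} [Nonempty S] [Nonempty A] {H : ℕ}
    (tr : Fin H → S × A) : ℕ → S × A :=
  fun n => if h : 0 < H then tr ⟨n % H, Nat.mod_lt n h⟩ else Classical.arbitrary (S × A)

/-- The empirical (maximum likelihood) estimate of the state-action distribution
computed from the dataset `D` of `m` trajectories. -/
noncomputable def empEst {S A : Type*} [Nonempty S] [Nonempty A]
    [DecidableEq S] [DecidableEq A] {H m : ℕ}
    (D : Fin m → Fin H → S × A) (h : ℕ) (s : S) (a : A) : ℝ :=
  (∑ i : Fin m, if extendTraj (D i) h = (s, a) then (1 : ℝ) else 0) / m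

/-- Expectation of `f` over a dataset of `m` i.i.d. trajectories drawn from the
trajectory distribution of `π`. -/
noncomputable def datasetExp {S A : Type*} [Fintype S] [Fintype A] [Nonempty S] [Nonempty A]
    (ρ : S → ℝ) (P : ℕ → S → A → S → ℝ) (π : ℕ → S → A → ℝ)
    (H m : ℕ) (f : (Fin m → Fin H → S × A) → ℝ) : ℝ :=
  ∑ D : Fin m → Fin H → S × A, (∏ i : Fin m, trajProb ρ P π H (extendTraj (D i))) * f D

lemma vail_sum_snoc {X : Type*} [Fintype X] (n : ℕ) (F : (Fin (n+1) → X) → ℝ) :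
    ∑ t : Fin (n+1) → X, F t = ∑ t : Fin n → X, ∑ x : X, F (Fin.snoc (α := fun _ => X) t x) := by
  rw [← (Fin.snocEquiv (fun _ : Fin (n+1) => X)).sum_comp, Fintype.sum_prod_type, Finset.sum_comm]
  rfl

lemma vail_sum_cons {X : Type*} [Fintype X] (n : ℕ) (F : (Fin (n+1) → X) → ℝ) :
    ∑ t : Fin (n+1) → X, F t = ∑ x : X, ∑ t : Fin n → X, F (Fin.cons (α := fun _ => X) x t) := by
  rw [← (Fin.consEquiv (fun _ : Fin (n+1) => X)).sum_comp, Fintype.sum_prod_type]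
  rfl

lemma vail_moments {T : Type*} [Fintype T] (w Y : T → ℝ) (hw : ∑ t, w t = 1)
    (hY : ∑ t, w t * Y t = 0) (m : ℕ) :
    (∑ D : Fin m → T, ∏ i, w (D i)) = 1 ∧
    (∑ D : Fin m → T, (∏ i, w (D i)) * (∑ i, Y (D i)) ^ 2) = m * ∑ t, w t * Y t ^ 2 := by
  induction m with
  | zero => simp
  | succ m ih =>
    obtain ⟨ih1, ih2⟩ := ih
    constructor
    · rw [vail_sum_cons]
      simp only [Fin.prod_univ_succ, Fin.cons_zero, Fin.cons_succ]
      simp only [← Finset.mul_sum, ih1, mul_one, hw]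
    · rw [vail_sum_cons]
      simp only [Fin.prod_univ_succ, Fin.sum_univ_succ, Fin.cons_zero, Fin.cons_succ]
      have key : ∀ t, ∑ D : Fin m → T, w t * (∏ i, w (D i)) * (Y t + ∑ i, Y (D i)) ^ 2
          = w t * Y t ^ 2 + 2 * (w t * Y t) * (∑ D : Fin m → T, (∏ i, w (D i)) * ∑ i, Y (D i))
            + w t * (m * ∑ t, w t * Y t ^ 2) := by
        intro t
        rw [← ih2]
        have : w t * Y t ^ 2 = w t * Y t ^ 2 * ∑ D : Fin m → T, ∏ i, w (D i) := by
          rw [ih1, mul_one]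
        rw [this]
        simp only [Finset.mul_sum (s := (Finset.univ : Finset (Fin m → T)))]
        rw [← Finset.sum_add_distrib, ← Finset.sum_add_distrib]
        refine Finset.sum_congr rfl fun D _ => ?_
        ring
      simp only [key]
      rw [Finset.sum_add_distrib, Finset.sum_add_distrib, ← Finset.sum_mul, ← Finset.sum_mul,
        ← Finset.mul_sum, hY, hw]
      push_cast
      ring

lemma vail_ext_lt {S A : Type*} [Nonempty S] [Nonempty A] {H : ℕ} (t : Fin H → S × A)
    (k : ℕ) (hk : k < H) : extendTraj t k = t ⟨k, hk⟩ := by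
  have h0 : 0 < H := by omega
  simp [extendTraj, h0, Nat.mod_eq_of_lt hk]

lemma vail_ext_snoc_lt {S A : Type*} [Nonempty S] [Nonempty A] {H : ℕ} (t : Fin H → S × A)
    (x : S × A) (k : ℕ) (hk : k < H) :
    extendTraj (Fin.snoc (α := fun _ => S × A) t x) k = extendTraj t k := by
  rw [vail_ext_lt _ k (by omega), vail_ext_lt _ k hk]
  exact Fin.snoc_castSucc (α := fun _ => S × A) x t ⟨k, hk⟩

lemma vail_ext_snoc_last {S A : Type*} [Nonempty S] [Nonempty A] {H : ℕ} (t : Fin H → S × A)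
    (x : S × A) :
    extendTraj (Fin.snoc (α := fun _ => S × A) t x) H = x := by
  rw [vail_ext_lt _ H (by omega)]
  exact Fin.snoc_last (α := fun _ => S × A) x t

lemma vail_trajProb_snoc {S A : Type*} [Fintype S] [Fintype A] [Nonempty S] [Nonempty A]
    (ρ : S → ℝ) (P : ℕ → S → A → S → ℝ) (π : ℕ → S → A → ℝ) (n : ℕ)
    (t : Fin (n+1) → S × A) (x : S × A) :
    trajProb ρ P π (n+2) (extendTraj (Fin.snoc (α := fun _ => S × A) t x)) =
      trajProb ρ P π (n+1) (extendTraj t) *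
        (P n (extendTraj t n).1 (extendTraj t n).2 x.1 * π (n+1) x.1 x.2) := by
  unfold trajProb
  rw [show n + 2 - 1 = n + 1 from rfl, show n + 1 - 1 = n from rfl, Finset.prod_range_succ,
    vail_ext_snoc_last, vail_ext_snoc_lt _ _ n (by omega), vail_ext_snoc_lt _ _ 0 (by omega),
    ← mul_assoc]
  congr 2
  refine Finset.prod_congr rfl fun l hl => ?_
  have := Finset.mem_range.1 hl
  rw [vail_ext_snoc_lt _ _ l (by omega), vail_ext_snoc_lt _ _ (l+1) (by omega)]

lemma vail_marginal {S A : Type*} [Fintype S] [Fintype A] [Nonempty S] [Nonempty A]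
    (ρ : S → ℝ) (P : ℕ → S → A → S → ℝ) (π : ℕ → S → A → ℝ)
    (hP : IsTransition P) (hπ : IsPolicy π) (n : ℕ) :
    ∀ h ≤ n, ∀ f : S × A → ℝ,
    ∑ t : Fin (n+1) → S × A, trajProb ρ P π (n+1) (extendTraj t) * f (extendTraj t h)
      = ∑ x : S × A, saDist ρ P π h x.1 x.2 * f x := by
  induction n with
  | zero =>
    intro h hh f
    obtain rfl : h = 0 := by omega
    rw [vail_sum_snoc]
    simp only [Fintype.sum_unique]
    refine Finset.sum_congr rfl fun x _ => ?_
    rw [vail_ext_snoc_last]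
    simp [trajProb, vail_ext_snoc_last, saDist, stateDist]
  | succ n ih =>
    intro h hh f
    rw [vail_sum_snoc]
    simp only [vail_trajProb_snoc]
    rcases Nat.lt_or_ge n h with h1 | h1
    · obtain rfl : h = n + 1 := by omega
      simp only [vail_ext_snoc_last]
      have := ih n le_rfl (fun y => ∑ x : S × A, P n y.1 y.2 x.1 * π (n+1) x.1 x.2 * f x)
      simp only [mul_assoc, ← Finset.mul_sum] at this ⊢
      rw [this]
      simp only [Finset.mul_sum]
      rw [Finset.sum_comm]
      refine Finset.sum_congr rfl fun x _ => ?_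
      simp only [saDist, stateDist, Finset.sum_mul]
      rw [Fintype.sum_prod_type]
      refine Finset.sum_congr rfl fun s _ => Finset.sum_congr rfl fun a _ => ?_
      ring
    · rw [← ih h h1 f]
      refine Finset.sum_congr rfl fun t _ => ?_
      simp only [vail_ext_snoc_lt t _ h (by omega)]
      rw [← Finset.sum_mul, ← Finset.mul_sum, Fintype.sum_prod_type]
      simp only [← Finset.mul_sum, (hπ _ _).2, mul_one, (hP _ _ _).2]

lemma vail_sd_nonneg {S A : Type*} [Fintype S] [Fintype A]
    {ρ : S → ℝ} {P : ℕ → S → A → S → ℝ} {π : ℕ → S → A → ℝ}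
    (hρ : IsInitDist ρ) (hP : IsTransition P) (hπ : IsPolicy π) (h : ℕ) (s : S) :
    0 ≤ stateDist ρ P π h s := by
  induction h generalizing s with
  | zero => exact hρ.1 s
  | succ h ih =>
    exact Finset.sum_nonneg fun s _ => Finset.sum_nonneg fun a _ =>
      mul_nonneg (mul_nonneg (ih s) ((hπ _ _).1 a)) ((hP _ _ _).1 _)

lemma vail_sd_sum {S A : Type*} [Fintype S] [Fintype A]
    {ρ : S → ℝ} {P : ℕ → S → A → S → ℝ} {π : ℕ → S → A → ℝ}
    (hρ : IsInitDist ρ) (hP : IsTransition P) (hπ : IsPolicy π) (h : ℕ) :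
    ∑ s, stateDist ρ P π h s = 1 := by
  induction h with
  | zero => exact hρ.2
  | succ h ih =>
    simp only [stateDist]
    rw [Finset.sum_comm, ← ih]
    refine Finset.sum_congr rfl fun s _ => ?_
    rw [Finset.sum_comm]
    simp only [← Finset.mul_sum, (hP _ _ _).2, mul_one, (hπ _ _).2]

lemma vail_trajProb_nonneg {S A : Type*} [Fintype S] [Fintype A]
    {ρ : S → ℝ} {P : ℕ → S → A → S → ℝ} {π : ℕ → S → A → ℝ}
    (hρ : IsInitDist ρ) (hP : IsTransition P) (hπ : IsPolicy π) (H : ℕ) (t : ℕ → S × A) :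
    0 ≤ trajProb ρ P π H t :=
  mul_nonneg (mul_nonneg (hρ.1 _) ((hπ _ _).1 _))
    (Finset.prod_nonneg fun _ _ => mul_nonneg ((hP _ _ _).1 _) ((hπ _ _).1 _))

/-- Expected absolute deviation of an empirical frequency. -/
lemma vail_dev {T : Type*} [Fintype T] (w X : T → ℝ) (hw0 : ∀ t, 0 ≤ w t) (hw : ∑ t, w t = 1)
    (p : ℝ) (hX : ∀ t, X t ^ 2 = X t) (hp : ∑ t, w t * X t = p) (m : ℕ) (hm : 1 ≤ m) :
    ∑ D : Fin m → T, (∏ i, w (D i)) * |p - (∑ i, X (D i)) / m| ≤ √(p * (1 - p) / m) := by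
  have hm0 : (m : ℝ) ≠ 0 := by positivity
  have hY : ∑ t, w t * (X t - p) = 0 := by
    simp only [mul_sub, Finset.sum_sub_distrib, ← Finset.sum_mul, hw, hp]; ring
  obtain ⟨h1, h2⟩ := vail_moments w (fun t => X t - p) hw hY m
  have hv : ∑ t, w t * (X t - p) ^ 2 = p * (1 - p) := by
    have : ∀ t, w t * (X t - p) ^ 2 = (1 - 2 * p) * (w t * X t) + p ^ 2 * w t := by
      intro t
      rw [sub_sq, hX]; ring
    simp only [this, Finset.sum_add_distrib, ← Finset.mul_sum, hw, hp]
    ring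
  rw [hv] at h2
  have hW0 : ∀ D : Fin m → T, 0 ≤ ∏ i, w (D i) := fun D => Finset.prod_nonneg fun i _ => hw0 _
  apply Real.le_sqrt_of_sq_le
  have cs := Finset.sum_sq_le_sum_mul_sum_of_sq_le_mul (Finset.univ : Finset (Fin m → T))
    (r := fun D => (∏ i, w (D i)) * |p - (∑ i, X (D i)) / m|)
    (f := fun D => ∏ i, w (D i)) (g := fun D => (∏ i, w (D i)) * (p - (∑ i, X (D i)) / m) ^ 2)
    (fun D _ => hW0 D) (fun D _ => mul_nonneg (hW0 D) (sq_nonneg _))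
    (fun D _ => le_of_eq (by rw [mul_pow, sq_abs]; ring))
  refine cs.trans (le_of_eq ?_)
  rw [h1, one_mul]
  have : ∀ D : Fin m → T, (∏ i, w (D i)) * (p - (∑ i, X (D i)) / m) ^ 2
      = (∏ i, w (D i)) * (∑ i, (X (D i) - p)) ^ 2 / m ^ 2 := by
    intro D
    have : p - (∑ i, X (D i)) / m = - (∑ i, (X (D i) - p)) / m := by
      simp only [Finset.sum_sub_distrib, Finset.sum_const, Finset.card_univ, Fintype.card_fin,
        nsmul_eq_mul]
      field_simp
      ring
    rw [this]; ring
  simp only [this]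
  rw [← Finset.sum_div, h2]
  field_simp

/-- Sum of standard deviations of a probability vector. -/
lemma vail_sum_sqrt {S : Type*} [Fintype S] (p : S → ℝ) (hp0 : ∀ s, 0 ≤ p s)
    (hp : ∑ s, p s = 1) (m : ℕ) :
    ∑ s, √(p s * (1 - p s) / m) ≤ √(((Fintype.card S : ℝ) - 1) / m) := by
  have hle : ∀ s, p s ≤ 1 := fun s => by
    rw [← hp]; exact Finset.single_le_sum (fun s _ => hp0 s) (Finset.mem_univ s)
  apply Real.le_sqrt_of_sq_le
  refine (sq_sum_le_card_mul_sum_sq).trans ?_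
  have e : ∀ s, √(p s * (1 - p s) / m) ^ 2 = (p s - p s ^ 2) / m := fun s => by
    rw [Real.sq_sqrt]
    · ring
    · exact div_nonneg (mul_nonneg (hp0 s) (by linarith [hle s])) (Nat.cast_nonneg _)
  simp only [e]
  rw [← Finset.sum_div, ← mul_div_assoc]
  have c := sq_sum_le_card_mul_sum_sq (s := (Finset.univ : Finset S)) (f := p)
  rw [hp] at c
  rw [Finset.sum_sub_distrib, hp]
  simp only [Finset.card_univ] at c ⊢
  apply div_le_div_of_nonneg_right _ (Nat.cast_nonneg _)
  nlinarith

lemma vail_value_diff {S A : Type*} [Fintype S] [Fintype A]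
    (ρ : S → ℝ) (P : ℕ → S → A → S → ℝ) (r : ℕ → S → A → ℝ) (hr : IsReward r)
    (π π' : ℕ → S → A → ℝ) (Q : ℕ → S → A → ℝ) (H : ℕ)
    (hmin : vailLoss ρ P π' Q H ≤ vailLoss ρ P π Q H) :
    |policyValue ρ P π r H - policyValue ρ P π' r H| ≤ 2 * vailLoss ρ P π Q H := by
  have : |policyValue ρ P π r H - policyValue ρ P π' r H|
      ≤ vailLoss ρ P π Q H + vailLoss ρ P π' Q H := by
    unfold policyValue vailLoss
    simp only [← Finset.sum_sub_distrib, ← Finset.sum_add_distrib]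
    refine (Finset.abs_sum_le_sum_abs _ _).trans (Finset.sum_le_sum fun h _ => ?_)
    refine (Finset.abs_sum_le_sum_abs _ _).trans (Finset.sum_le_sum fun s _ => ?_)
    refine (Finset.abs_sum_le_sum_abs _ _).trans (Finset.sum_le_sum fun a _ => ?_)
    rw [← sub_mul, abs_mul, abs_of_nonneg (hr h s a).1]
    refine (mul_le_of_le_one_right (abs_nonneg _) (hr h s a).2).trans ?_
    rw [abs_sub_comm (saDist ρ P π' h s a)]
    exact abs_sub_le _ _ _
  linarith

/-- for any episodic tabular MDP with a deterministic expert policy, if the dataset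
`D` consists of `m ≥ 1` i.i.d. expert trajectories, `empEst D` is the empirical MLE of the
expert state-action distributions, and `πAIL D` is any choice of global minimizer of the VAIL
objective, then `E_D[|V^{πE} − V^{πAIL(D)}|] ≤ 2H √((|S|−1)/m)`. -/
theorem vail_expected_sample_complexity {S A : Type*} [Fintype S] [Fintype A]
    [Nonempty S] [Nonempty A] [DecidableEq S] [DecidableEq A]
    (ρ : S → ℝ) (P : ℕ → S → A → S → ℝ) (r : ℕ → S → A → ℝ) (πE : ℕ → S → A → ℝ)
    (H : ℕ) (hH : 1 ≤ H)
    (hρ : IsInitDist ρ) (hP : IsTransition P) (hr : IsReward r) (hE : IsPolicy πE)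
    (hdet : ∀ h s, ∃ a0 : A, ∀ a, πE h s a = if a = a0 then (1 : ℝ) else 0)
    (m : ℕ) (hm : 1 ≤ m)
    (πAIL : (Fin m → Fin H → S × A) → ℕ → S → A → ℝ)
    (hpol : ∀ D, IsPolicy (πAIL D))
    (hmin : ∀ D, ∀ π, IsPolicy π →
      vailLoss ρ P (πAIL D) (empEst D) H ≤ vailLoss ρ P π (empEst D) H) :
    datasetExp ρ P πE H m
        (fun D => |policyValue ρ P πE r H - policyValue ρ P (πAIL D) r H|)
      ≤ 2 * H * Real.sqrt (((Fintype.card S : ℝ) - 1) / m) := by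
  have hW0 : ∀ D : Fin m → Fin H → S × A, 0 ≤ ∏ i, trajProb ρ P πE H (extendTraj (D i)) :=
    fun D => Finset.prod_nonneg fun i _ => vail_trajProb_nonneg hρ hP hE H _
  obtain ⟨n, rfl⟩ : ∃ n, H = n + 1 := ⟨H - 1, by omega⟩
  have hsa : ∀ h, ∑ x : S × A, saDist ρ P πE h x.1 x.2 = 1 := fun h => by
    rw [Fintype.sum_prod_type]
    simp only [saDist, ← Finset.mul_sum, (hE _ _).2, mul_one, vail_sd_sum hρ hP hE]
  have hw : ∑ t : Fin (n+1) → S × A, trajProb ρ P πE (n+1) (extendTraj t) = 1 := by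
    have := vail_marginal ρ P πE hP hE n 0 (by omega) (fun _ => 1)
    simpa [hsa] using this
  have hstep : ∀ h ∈ Finset.range (n+1), ∑ s : S, ∑ a : A, ∑ D : Fin m → Fin (n+1) → S × A,
      (∏ i, trajProb ρ P πE (n+1) (extendTraj (D i))) * |saDist ρ P πE h s a - empEst D h s a|
      ≤ √(((Fintype.card S : ℝ) - 1) / m) := by
    intro h hh
    have hh' := Finset.mem_range.1 hh
    refine le_trans (Finset.sum_le_sum fun s _ => ?_)
      (vail_sum_sqrt (stateDist ρ P πE h) (vail_sd_nonneg hρ hP hE h) (vail_sd_sum hρ hP hE h) m)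
    have hd : ∀ a, ∑ D : Fin m → Fin (n+1) → S × A,
      (∏ i, trajProb ρ P πE (n+1) (extendTraj (D i))) * |saDist ρ P πE h s a - empEst D h s a|
        ≤ √(saDist ρ P πE h s a * (1 - saDist ρ P πE h s a) / m) := by
      intro a
      refine vail_dev (fun t : Fin (n+1) → S × A => trajProb ρ P πE (n+1) (extendTraj t))
        (fun t => if extendTraj t h = (s, a) then (1 : ℝ) else 0)
        (fun t => vail_trajProb_nonneg hρ hP hE _ _) hw _ (fun t => by split_ifs <;> simp) ?_ m hm
      rw [vail_marginal ρ P πE hP hE n h (by omega) (fun x => if x = (s, a) then (1 : ℝ) else 0)]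
      simp
    refine (Finset.sum_le_sum fun a _ => hd a).trans (le_of_eq ?_)
    obtain ⟨a0, ha0⟩ := hdet h s
    rw [Finset.sum_eq_single a0]
    · simp [saDist, ha0]
    · intro b _ hb
      simp [saDist, ha0, hb]
    · simp
  have hbound : datasetExp ρ P πE (n+1) m
        (fun D => |policyValue ρ P πE r (n+1) - policyValue ρ P (πAIL D) r (n+1)|)
      ≤ 2 * ∑ h ∈ Finset.range (n+1), ∑ s : S, ∑ a : A, ∑ D : Fin m → Fin (n+1) → S × A,
      (∏ i, trajProb ρ P πE (n+1) (extendTraj (D i)))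
        * |saDist ρ P πE h s a - empEst D h s a| := by
    unfold datasetExp
    refine (Finset.sum_le_sum fun D _ => mul_le_mul_of_nonneg_left
      (vail_value_diff ρ P r hr πE (πAIL D) (empEst D) (n+1) (hmin D πE hE)) (hW0 D)).trans
      (le_of_eq ?_)
    simp only [mul_left_comm _ (2 : ℝ), vailLoss]
    rw [← Finset.mul_sum]
    congr 1
    simp only [Finset.mul_sum]
    rw [Finset.sum_comm]
    refine Finset.sum_congr rfl fun h _ => ?_
    rw [Finset.sum_comm]
    refine Finset.sum_congr rfl fun s _ => ?_
    rw [Finset.sum_comm]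
  refine hbound.trans ?_
  have := Finset.sum_le_sum hstep
  rw [Finset.sum_const, Finset.card_range, nsmul_eq_mul] at this
  rw [mul_assoc]
  exact mul_le_mul_of_nonneg_left this (by norm_num)
end

section
/- Let M satisfy the Reset Cliff assumption and let (P̂_h)_{h=1}^H be admissible estimates. Define S(P̂_H) = {s ∈ S : P̂_H(s,a¹) > 0}. If π^{AIL} is any global minimizer of the VAIL objective L(π) = Σ_{h=1}^H Σ_{(s,a)} |P^π_h(s,a) − P̂_h(s,a)|, then π^{AIL}_H(a¹|s) > 0 for every s ∈ S(P̂_H). -/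
open Finset

/-- The Reset Cliff assumption: good states `G` (with bad states `Gᶜ`), expert action `a1`. -/
def ResetCliff {S A : Type*} [Fintype S] [Fintype A] [DecidableEq S]
    (ρ : S → ℝ) (P : ℕ → S → A → S → ℝ) (r : ℕ → S → A → ℝ)
    (G : Finset S) (a1 : A) : Prop :=
  G.Nonempty ∧
  (∀ (h : ℕ), ∀ s ∈ G, r h s a1 = 1) ∧
  (∀ (h : ℕ) (s : S) (a : A), (s ∉ G ∨ a ≠ a1) → r h s a = 0) ∧
  (∀ (h : ℕ), ∀ s ∈ G, (∑ s' ∈ G, P h s a1 s') = 1) ∧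
  (∀ (h : ℕ), ∀ s ∈ G, ∀ s' ∈ G, 0 < P h s a1 s') ∧
  (∀ (h : ℕ), ∀ s ∈ G, ∀ a : A, a ≠ a1 → (∑ s' ∈ Gᶜ, P h s a s') = 1) ∧
  (∀ (h : ℕ), ∀ s ∉ G, ∀ a : A, (∑ s' ∈ Gᶜ, P h s a s') = 1) ∧
  (∀ s ∈ G, 0 < ρ s) ∧
  (∀ s ∉ G, ρ s = 0)

/-- Admissible estimates for the expert state-action distributions on a Reset Cliff instance. -/
def AdmissibleEst {S A : Type*} [Fintype S] [DecidableEq S]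
    (G : Finset S) (a1 : A) (Q : ℕ → S → A → ℝ) (H : ℕ) : Prop :=
  ∀ h < H, (∀ s a, 0 ≤ Q h s a) ∧
    (∀ (s : S) (a : A), (s ∉ G ∨ a ≠ a1) → Q h s a = 0) ∧
    (∑ s ∈ G, Q h s a1) = 1

theorem stateDist_nonneg_aux {S A : Type*} [Fintype S] [Fintype A]
    (ρ : S → ℝ) (P : ℕ → S → A → S → ℝ) (π : ℕ → S → A → ℝ)
    (hρ : IsInitDist ρ) (hP : IsTransition P) (hπ : IsPolicy π) (h : ℕ) (s : S) :
    0 ≤ stateDist ρ P π h s := by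
  induction h generalizing s with
  | zero => exact hρ.1 s
  | succ h ih =>
    simp only [stateDist]
    exact sum_nonneg fun t _ => sum_nonneg fun a _ =>
      mul_nonneg (mul_nonneg (ih t) ((hπ h t).1 a)) ((hP h t a).1 s)

theorem saDist_sum_aux {S A : Type*} [Fintype S] [Fintype A]
    (ρ : S → ℝ) (P : ℕ → S → A → S → ℝ) (π : ℕ → S → A → ℝ)
    (hρ : IsInitDist ρ) (hP : IsTransition P) (hπ : IsPolicy π) (h : ℕ) :
    ∑ s : S, ∑ a : A, saDist ρ P π h s a = 1 := by
  have key : ∀ h, ∑ s : S, ∑ a : A, saDist ρ P π h s a = ∑ s : S, stateDist ρ P π h s := by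
    intro h
    refine sum_congr rfl fun s _ => ?_
    simp only [saDist]
    rw [← mul_sum, (hπ h s).2, mul_one]
  induction h with
  | zero => rw [key]; exact hρ.2
  | succ h ih =>
    rw [key, ← ih]
    simp only [stateDist, saDist]
    rw [sum_comm]
    refine sum_congr rfl fun s _ => ?_
    rw [sum_comm]
    refine sum_congr rfl fun a _ => ?_
    rw [← mul_sum, (hP h s a).2, mul_one]

theorem policy_le_one_aux {S A : Type*} [Fintype A] (π : ℕ → S → A → ℝ)
    (hπ : IsPolicy π) (h : ℕ) (s : S) (a : A) : π h s a ≤ 1 := by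
  rw [← (hπ h s).2]
  exact single_le_sum (f := fun a => π h s a) (fun b _ => (hπ h s).1 b) (mem_univ a)

theorem compl_zero_aux {S : Type*} [Fintype S] [DecidableEq S] (p : S → ℝ) (G : Finset S)
    (h0 : ∀ s, 0 ≤ p s) (h1 : ∑ s, p s = 1) (hc : ∑ s ∈ Gᶜ, p s = 1) :
    ∀ s ∈ G, p s = 0 := by
  have := sum_add_sum_compl G p
  have h2 : ∑ s ∈ G, p s = 0 := by linarith
  exact (sum_eq_zero_iff_of_nonneg fun s _ => h0 s).1 h2

/-- on any Reset Cliff instance with admissible estimates, any global minimizer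
`πAIL` of the VAIL objective plays the expert action `a1` with positive probability in the last
time step on every state `s` with `P̂_H(s,a¹) > 0` (the last time step is `H − 1` since time
steps are 0-indexed). -/
theorem vail_minimizer_positive_last_step {S A : Type*} [Fintype S] [Fintype A]
    [Nonempty S] [Nonempty A] [DecidableEq S]
    (ρ : S → ℝ) (P : ℕ → S → A → S → ℝ) (r : ℕ → S → A → ℝ)
    (πE πAIL : ℕ → S → A → ℝ) (G : Finset S) (a1 : A)
    (Q : ℕ → S → A → ℝ) (H : ℕ) (hH : 1 ≤ H)
    (hρ : IsInitDist ρ) (hP : IsTransition P) (hr : IsReward r)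
    (hE : IsPolicy πE) (hAILpol : IsPolicy πAIL)
    (hRC : ResetCliff ρ P r G a1)
    (hEa : ∀ h s, πE h s a1 = 1)
    (hQ : AdmissibleEst G a1 Q H)
    (hmin : ∀ π, IsPolicy π → vailLoss ρ P πAIL Q H ≤ vailLoss ρ P π Q H) :
    ∀ s : S, 0 < Q (H - 1) s a1 → 0 < πAIL (H - 1) s a1 := by
  intro s hs
  obtain ⟨-, -, -, -, hPpos, hPa, hPb, hρG, -⟩ := hRC
  by_contra hneg
  have hzero : πAIL (H - 1) s a1 = 0 :=
    le_antisymm (not_lt.1 hneg) ((hAILpol (H - 1) s).1 a1)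
  have hlast : H - 1 < H := by omega
  have hsG : s ∈ G := by
    by_contra hc
    exact hs.ne' ((hQ _ hlast).2.1 s a1 (Or.inl hc))
  have hPz : ∀ h t a, (t ∉ G ∨ a ≠ a1) → ∀ u ∈ G, P h t a u = 0 := by
    intro h t a hta
    refine compl_zero_aux _ G (hP h t a).1 (hP h t a).2 ?_
    by_cases ht : t ∈ G
    · rcases hta with h1 | h1
      · exact absurd ht h1
      · exact hPa h t ht a h1
    · exact hPb h t ht a
  have nnE := stateDist_nonneg_aux ρ P πE hρ hP hE
  have nnA := stateDist_nonneg_aux ρ P πAIL hρ hP hAILpol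
  have hdom : ∀ h, ∀ t ∈ G, stateDist ρ P πAIL h t ≤ stateDist ρ P πE h t := by
    intro h
    induction h with
    | zero => intro t _; exact le_rfl
    | succ h ih =>
      intro t ht
      simp only [stateDist]
      refine sum_le_sum fun u _ => sum_le_sum fun a _ => ?_
      by_cases hu : u ∉ G ∨ a ≠ a1
      · simp [hPz h u a hu t ht]
      · push Not at hu
        obtain ⟨hu, rfl⟩ := hu
        refine mul_le_mul_of_nonneg_right ?_ ((hP h u a).1 t)
        exact mul_le_mul (ih u hu) (by rw [hEa]; exact policy_le_one_aux _ hAILpol _ _ _)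
          ((hAILpol h u).1 a) (nnE h u)
  have hpos : ∀ h, ∀ t ∈ G, 0 < stateDist ρ P πE h t := by
    intro h
    induction h with
    | zero => exact hρG
    | succ h ih =>
      intro t ht
      simp only [stateDist]
      have hn : ∀ u a, 0 ≤ stateDist ρ P πE h u * πE h u a * P h u a t := fun u a =>
        mul_nonneg (mul_nonneg (nnE h u) ((hE h u).1 a)) ((hP h u a).1 t)
      refine sum_pos' (fun u _ => sum_nonneg fun a _ => hn u a) ⟨t, mem_univ t, ?_⟩
      refine sum_pos' (fun a _ => hn t a) ⟨a1, mem_univ a1, ?_⟩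
      rw [hEa, mul_one]
      exact mul_pos (ih t ht) (hPpos h t ht t ht)
  have hterm : ∀ h < H, ∀ t a, |saDist ρ P πE h t a - Q h t a| - saDist ρ P πE h t a
      ≤ |saDist ρ P πAIL h t a - Q h t a| - saDist ρ P πAIL h t a := by
    intro h hh t a
    by_cases hta : t ∉ G ∨ a ≠ a1
    · rw [(hQ h hh).2.1 t a hta, sub_zero, sub_zero]
      unfold saDist
      rw [abs_of_nonneg (mul_nonneg (nnE h t) ((hE h t).1 a)),
        abs_of_nonneg (mul_nonneg (nnA h t) ((hAILpol h t).1 a))]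
      simp
    · push Not at hta
      obtain ⟨ht, rfl⟩ := hta
      have hle : saDist ρ P πAIL h t a ≤ saDist ρ P πE h t a :=
        mul_le_mul (hdom h t ht) (by rw [hEa]; exact policy_le_one_aux _ hAILpol _ _ _)
          ((hAILpol h t).1 a) (nnE h t)
      have := abs_sub_abs_le_abs_sub (saDist ρ P πE h t a - Q h t a)
        (saDist ρ P πAIL h t a - Q h t a)
      rw [sub_sub_sub_cancel_right, abs_of_nonneg (sub_nonneg.2 hle)] at this
      linarith
  have hstrict : |saDist ρ P πE (H - 1) s a1 - Q (H - 1) s a1| - saDist ρ P πE (H - 1) s a1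
      < |saDist ρ P πAIL (H - 1) s a1 - Q (H - 1) s a1| - saDist ρ P πAIL (H - 1) s a1 := by
    have hd := hpos (H - 1) s hsG
    simp only [saDist, hzero, hEa, mul_one, mul_zero, zero_sub, abs_neg, sub_zero]
    rw [abs_of_pos hs]
    rcases abs_cases (stateDist ρ P πE (H - 1) s - Q (H - 1) s a1) with h | h <;> linarith
  have hloss : ∀ π, IsPolicy π → vailLoss ρ P π Q H =
      (∑ h ∈ range H, ∑ t : S, ∑ a : A, (|saDist ρ P π h t a - Q h t a| - saDist ρ P π h t a))
        + H := by
    intro π hπ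
    simp only [vailLoss, sum_sub_distrib, saDist_sum_aux ρ P π hρ hP hπ]
    simp
  have hm := hmin πE hE
  rw [hloss _ hE, hloss _ hAILpol] at hm
  refine absurd hm (not_le.2 (add_lt_add_left ?_ _))
  refine sum_lt_sum (fun h hh => sum_le_sum fun t _ => sum_le_sum fun a _ =>
    hterm h (mem_range.1 hh) t a) ⟨H - 1, mem_range.2 hlast, ?_⟩
  refine sum_lt_sum (fun t _ => sum_le_sum fun a _ => hterm _ hlast t a) ⟨s, mem_univ s, ?_⟩
  exact sum_lt_sum (fun a _ => hterm _ hlast s a) ⟨a1, mem_univ a1, hstrict⟩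
end
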